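/- Let ε > 0 and μ > 0 satisfy: μ > 1 + ε if 0 ≤ ε ≤ 1, and μ > 1 + 1/ε if ε > 1. Then there exists K such that for every integer k ≥ K with k − 2 a power of a prime, if t = k^ε is a positive integer and r = ⌈μt⌉ with r − 1 a power of a prime, then there exists a (k+r, k) systematic t-error-correcting code, i.e., a code C ⊆ S_{k+r} of size k! such that for every σ ∈ S_k there is exactly one α ∈ C with α_{↓k} = σ, and distinct codewords of C have Kendall τ-distance at least 2t+1. -/

import Mathlib

/-- `AdjTrans σ π` : the sequence `π` is obtained from the sequence `σ` by exchanging
two distinct adjacent elements (an adjacent transposition). -/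
def AdjTrans (σ π : List ℤ) : Prop :=
  ∃ (l₁ l₂ : List ℤ) (a b : ℤ), a ≠ b ∧ σ = l₁ ++ a :: b :: l₂ ∧ π = l₁ ++ b :: a :: l₂

/-- `StepsTo n σ π` : `π` can be obtained from `σ` by a sequence of `n` adjacent
transpositions. -/
def StepsTo : ℕ → List ℤ → List ℤ → Prop
  | 0 => fun σ π => σ = π
  | n + 1 => fun σ π => ∃ τ, AdjTrans σ τ ∧ StepsTo n τ π

/-- The Kendall τ-distance between two sequences: the minimum number of adjacent
transpositions needed to transform one into the other. -/
noncomputable def dK (σ π : List ℤ) : ℕ := sInf {n | StepsTo n σ π}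

/-- The list `[a, a+1, ..., a+len-1]` of integers. -/
def rangeList (a len : ℕ) : List ℤ := (List.range' a len).map (fun x => (x : ℤ))

/-- The substitution map `T_θ`: the `r`-th occurrence (from the left, `0`-indexed) of a
rank `a` in `σ` is replaced by the `r`-th entry of the list `θ a`. -/
def Tmap (θ : ℤ → List ℤ) (σ : List ℤ) : List ℤ :=
  (List.range σ.length).map (fun j =>
    (θ (σ.getD j 0)).getD ((σ.take j).count (σ.getD j 0)) 0)

/-- `psiEntry σ a s` : the number of positions in `σ` strictly to the right of the `s`-th
occurrence (`0`-indexed) of `a` in `σ` that hold an element smaller than `a`. -/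
def psiEntry (σ : List ℤ) (a : ℤ) (s : ℕ) : ℕ :=
  (σ.drop (((σ.indexesOf a).getD s σ.length) + 1)).countP (fun x => decide (x < a))

/-- The Manhattan distance between two vectors of naturals (presented as lists). -/
def manhattanL (x y : List ℕ) : ℕ :=
  ∑ i ∈ Finset.range (max x.length y.length), ((x.getD i 0 : ℤ) - (y.getD i 0 : ℤ)).natAbs

/-- The Lee distance over `Z_q` between two vectors with entries in `{0, …, q-1}`
(presented as lists). -/
def leeDistL (q : ℕ) (x y : List ℕ) : ℕ :=
  ∑ i ∈ Finset.range (max x.length y.length),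
    min (((x.getD i 0 : ℤ) - (y.getD i 0 : ℤ)).natAbs)
      (q - ((x.getD i 0 : ℤ) - (y.getD i 0 : ℤ)).natAbs)

/-- The Lee distance between two vectors over `ZMod q`. -/
def zmodLee {q N : ℕ} (x y : Fin N → ZMod q) : ℕ :=
  ∑ i, min (x i - y i).val (y i - x i).val

/-- `permList k σ` : `σ` is (an ordering representing) a permutation of `{1, …, k}`. -/
def permList (k : ℕ) (σ : List ℤ) : Prop :=
  (↑σ : Multiset ℤ) = (↑(rangeList 1 k) : Multiset ℤ)

/-- The multiset `M_{k,r} = {0^k, k+1, …, k+r}`. -/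
def Mkr (k r : ℕ) : Multiset ℤ :=
  Multiset.replicate k (0 : ℤ) + (↑(rangeList (k + 1) r) : Multiset ℤ)

/-- `α_{↓k}` : delete from `α` all elements larger than `k`. -/
def restrictTo (k : ℕ) (α : List ℤ) : List ℤ :=
  α.filter (fun x => decide (x ≤ (k : ℤ)))

/-- `α_{k↦0}` : replace in `α` every element of `{1, …, k}` by `0`. -/
def mapToZero (k : ℕ) (α : List ℤ) : List ℤ :=
  α.map (fun x => if 1 ≤ x ∧ x ≤ (k : ℤ) then 0 else x)

/-- `star σ ρ = σ ∗ ρ` : replace the zeros of `ρ`, from left to right, by the elements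
of `σ` in order. -/
def starP : List ℤ → List ℤ → List ℤ
  | _, [] => []
  | σ, x :: ρ' => if x = 0 then σ.headD 0 :: starP σ.tail ρ' else x :: starP σ ρ'

section Helpers

/-- inversion vector entry -/
def invc (a : ℤ) : List ℤ → ℕ
  | [] => 0
  | h :: t => (if h = a then t.countP (fun x => decide (x < a)) else 0) + invc a t

/-- permutation with a given inversion vector -/
def bld (x : ℕ → ℕ) : ℕ → List ℤ
  | 0 => []
  | n + 1 => (bld x n).take (n - x (n + 1)) ++ ((n + 1 : ℕ) : ℤ) :: (bld x n).drop (n - x (n + 1))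

theorem invc_append (a : ℤ) (l₁ l₂ : List ℤ) :
    invc a (l₁ ++ l₂) =
      invc a l₁ + l₁.count a * l₂.countP (fun x => decide (x < a)) + invc a l₂ := by
  induction l₁ with
  | nil => simp [invc]
  | cons h t ih =>
    simp only [List.cons_append, invc, ih, List.countP_append, List.count_cons]
    by_cases hh : h = a
    · simp [hh]; ring
    · simp [hh]

theorem invc_insert (a m : ℤ) (h : a < m) (l₁ l₂ : List ℤ) :
    invc a (l₁ ++ m :: l₂) = invc a (l₁ ++ l₂) := by
  have h1 : m ≠ a := by omega
  have h2 : ¬ m < a := by omega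
  simp [invc_append, invc, h1, h2]

theorem invc_not_mem (a : ℤ) (l : List ℤ) (h : a ∉ l) : invc a l = 0 := by
  induction l with
  | nil => rfl
  | cons b t ih =>
    simp only [List.mem_cons, not_or] at h
    have : ¬ b = a := fun e => h.1 e.symm
    simp [invc, this, ih h.2]

theorem rangeList_eq (a n : ℕ) :
    rangeList a n = (List.range' a n).map (Nat.cast : ℕ → ℤ) := by
  unfold rangeList
  rw [List.map_id']
  rw [bind_pure_comp]
  rfl

theorem rangeList_succ (n : ℕ) : rangeList 1 (n + 1) = rangeList 1 n ++ [((n + 1 : ℕ) : ℤ)] := by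
  simp [rangeList_eq, List.range'_concat, add_comm]

theorem permList_iff (n : ℕ) (l : List ℤ) : permList n l ↔ l.Perm (rangeList 1 n) := by
  simp [permList]

theorem mem_rangeList (n : ℕ) (a : ℤ) : a ∈ rangeList 1 n ↔ 1 ≤ a ∧ a ≤ n := by
  simp only [rangeList_eq, List.mem_map, List.mem_range'_1]
  constructor
  · rintro ⟨b, hb, rfl⟩; omega
  · intro h; exact ⟨a.toNat, by omega, by omega⟩

theorem perm_insert (n : ℕ) (l₁ l₂ : List ℤ) :
    permList (n + 1) (l₁ ++ ((n + 1 : ℕ) : ℤ) :: l₂) ↔ permList n (l₁ ++ l₂) := by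
  rw [permList_iff, permList_iff, rangeList_succ]
  have e1 := List.perm_middle (a := ((n + 1 : ℕ) : ℤ)) (l₁ := l₁) (l₂ := l₂)
  have e2 := List.perm_append_singleton ((n + 1 : ℕ) : ℤ) (rangeList 1 n)
  constructor
  · intro h
    exact List.Perm.cons_inv (e1.symm.trans (h.trans e2))
  · intro h
    exact e1.trans ((h.cons _).trans e2.symm)

theorem permList_bld (x : ℕ → ℕ) (n : ℕ) : permList n (bld x n) := by
  induction n with
  | zero => simp [bld, permList, rangeList]
  | succ n ih =>
    rw [bld, perm_insert, List.take_append_drop]; exact ih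

theorem permList_mem {n : ℕ} {l : List ℤ} (h : permList n l) (a : ℤ) :
    a ∈ l ↔ 1 ≤ a ∧ a ≤ n := by
  rw [((permList_iff _ _).1 h).mem_iff, mem_rangeList]

theorem permList_length {n : ℕ} {l : List ℤ} (h : permList n l) : l.length = n := by
  rw [((permList_iff _ _).1 h).length_eq]; simp [rangeList_eq]

theorem invc_bld (x : ℕ → ℕ) (n : ℕ) (hx : ∀ a, 1 ≤ a → a ≤ n → x a < a) (a : ℕ) (h1 : 1 ≤ a)
    (h2 : a ≤ n) : invc (a : ℤ) (bld x n) = x a := by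
  induction n with
  | zero => omega
  | succ n ih =>
    have hp := permList_bld x n
    have hl := permList_length hp
    by_cases ha : a = n + 1
    · subst ha
      have hnm : ((n + 1 : ℕ) : ℤ) ∉ bld x n := by
        rw [permList_mem hp]; push_cast; omega
      have n1 : ((n + 1 : ℕ) : ℤ) ∉ (bld x n).take (n - x (n + 1)) :=
        fun h => hnm (List.mem_of_mem_take h)
      have n2 : ((n + 1 : ℕ) : ℤ) ∉ (bld x n).drop (n - x (n + 1)) :=
        fun h => hnm (List.mem_of_mem_drop h)
      have hc : ((bld x n).drop (n - x (n + 1))).countP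
          (fun y => decide (y < ((n + 1 : ℕ) : ℤ))) = ((bld x n).drop (n - x (n + 1))).length := by
        rw [List.countP_eq_length]
        intro y hy
        have := (permList_mem hp y).1 (List.mem_of_mem_drop hy)
        simp only [decide_eq_true_eq]; push_cast; omega
      have hb := hx (n + 1) h1 le_rfl
      rw [bld, invc_append, invc_not_mem _ _ n1, List.count_eq_zero_of_not_mem n1]
      simp only [invc]
      rw [invc_not_mem _ _ n2]
      simp only [if_true]
      rw [hc, List.length_drop, hl]
      omega
    · rw [bld, invc_insert _ _ (by push_cast; omega), List.take_append_drop]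
      exact ih (fun a h1 h2 => hx a h1 (by omega)) (by omega)

theorem bld_congr (x y : ℕ → ℕ) (n : ℕ) (h : ∀ a, 1 ≤ a → a ≤ n → x a = y a) :
    bld x n = bld y n := by
  induction n with
  | zero => rfl
  | succ n ih =>
    rw [bld, bld, ih (fun a h1 h2 => h a h1 (by omega)), h (n + 1) (by omega) le_rfl]

theorem exists_bld (n : ℕ) (σ : List ℤ) (h : permList n σ) :
    ∃ x : ℕ → ℕ, (∀ a, 1 ≤ a → a ≤ n → x a < a) ∧ bld x n = σ := by
  induction n generalizing σ with
  | zero =>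
    refine ⟨fun _ => 0, by intros; omega, ?_⟩
    have := permList_length h
    rw [List.length_eq_zero_iff] at this
    simp [bld, this]
  | succ n ih =>
    have hm : ((n + 1 : ℕ) : ℤ) ∈ σ := by rw [permList_mem h]; push_cast; omega
    obtain ⟨l₁, l₂, rfl⟩ := List.append_of_mem hm
    rw [perm_insert] at h
    obtain ⟨x, hx, hb⟩ := ih _ h
    have hl := permList_length h
    rw [List.length_append] at hl
    refine ⟨Function.update x (n + 1) l₂.length, ?_, ?_⟩
    · intro a h1 h2
      by_cases ha : a = n + 1
      · subst ha; simp; omega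
      · rw [Function.update_of_ne ha]; exact hx a h1 (by omega)
    · have : bld (Function.update x (n + 1) l₂.length) n = l₁ ++ l₂ := by
        rw [← hb]; apply bld_congr
        intro a _ h2
        rw [Function.update_of_ne (by omega)]
      have e : n - l₂.length = l₁.length := by omega
      rw [bld, this, Function.update_self, e]
      simp

theorem restrict_bld (x : ℕ → ℕ) (k r : ℕ) : restrictTo k (bld x (k + r)) = bld x k := by
  induction r with
  | zero =>
    rw [restrictTo, Nat.add_zero, List.filter_eq_self]
    intro a ha
    have := (permList_mem (permList_bld x _) a).1 ha
    simpa using this.2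
  | succ r ih =>
    rw [← add_assoc, bld, restrictTo, List.filter_append, List.filter_cons_of_neg, ← List.filter_append,
      List.take_append_drop]
    · exact ih
    · simp only [decide_eq_true_eq]; push_cast; omega

theorem permList_restrict (k : ℕ) (x : ℕ → ℕ) (σ : List ℤ) (h : permList k σ)
    (hx : ∀ a, 1 ≤ a → a ≤ k → x a = invc (a : ℤ) σ) : bld x k = σ := by
  obtain ⟨y, hy, rfl⟩ := exists_bld k σ h
  apply bld_congr
  intro a h1 h2
  rw [hx a h1 h2, invc_bld y k hy a h1 h2]

theorem invc_lt (k : ℕ) (σ : List ℤ) (h : permList k σ) (a : ℕ) (h1 : 1 ≤ a) (h2 : a ≤ k) :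
    invc (a : ℤ) σ < a := by
  obtain ⟨y, hy, rfl⟩ := exists_bld k σ h
  rw [invc_bld y k hy a h1 h2]; exact hy a h1 h2

/-- l1 distance of inversion vectors -/
def idist (n : ℕ) (x y : ℕ → ℕ) : ℤ := ∑ a ∈ Finset.Icc 1 n, |(x a : ℤ) - (y a : ℤ)|

theorem idist_triangle (n : ℕ) (x y z : ℕ → ℕ) : idist n x z ≤ idist n x y + idist n y z := by
  unfold idist
  rw [← Finset.sum_add_distrib]
  exact Finset.sum_le_sum fun a _ => abs_sub_le _ _ _

theorem adj_idist (n : ℕ) (σ π : List ℤ) (h : AdjTrans σ π) :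
    idist n (fun a => invc (a : ℤ) σ) (fun a => invc (a : ℤ) π) ≤ 1 := by
  obtain ⟨l₁, l₂, a, b, hab, rfl, rfl⟩ := h
  have key : ∀ c : ℤ, |(invc c (l₁ ++ a :: b :: l₂) : ℤ) - (invc c (l₁ ++ b :: a :: l₂) : ℤ)|
      = if c = max a b then 1 else 0 := by
    intro c
    simp only [invc_append, invc, List.countP_cons]
    rcases lt_or_gt_of_ne hab with h | h
    · rw [max_eq_right h.le]
      by_cases hb : c = b
      · subst hb
        have : ¬ c < a := by omega
        simp [h, h.ne]
      · have hb' : ¬ b = c := fun e => hb e.symm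
        by_cases ha : a = c
        · subst ha
          have : ¬ b < a := by omega
          simp [hb, hb', this]
        · simp [hb, hb', ha]
          ring
    · rw [max_eq_left h.le]
      by_cases hb : c = a
      · subst hb
        have : ¬ c < b := by omega
        simp [h, h.ne]
      · have hb' : ¬ a = c := fun e => hb e.symm
        by_cases ha : b = c
        · subst ha
          have : ¬ a < b := by omega
          simp [hb, hb', this]
        · simp [hb, hb', ha]
          ring
  unfold idist
  simp only [key]
  rw [← Finset.sum_filter, Finset.sum_const]
  simp only [nsmul_eq_mul, mul_one]
  have : (Finset.filter (fun c : ℕ => (c : ℤ) = max a b) (Finset.Icc 1 n)).card ≤ 1 := by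
    rw [Finset.card_le_one]
    intro x hx y hy
    simp only [Finset.mem_filter] at hx hy
    have := hx.2.trans hy.2.symm
    exact_mod_cast this
  exact_mod_cast this

theorem steps_idist (n m : ℕ) (σ π : List ℤ) (h : StepsTo m σ π) :
    idist n (fun a => invc (a : ℤ) σ) (fun a => invc (a : ℤ) π) ≤ m := by
  induction m generalizing σ with
  | zero => cases h; simp [idist]
  | succ m ih =>
    obtain ⟨τ, h1, h2⟩ := h
    have := idist_triangle n (fun a => invc (a : ℤ) σ) (fun a => invc (a : ℤ) τ)
      (fun a => invc (a : ℤ) π)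
    have := ih _ h2
    have := adj_idist n _ _ h1
    push_cast; linarith

theorem steps_trans (m n : ℕ) (σ τ π : List ℤ) (h : StepsTo m σ τ) (h' : StepsTo n τ π) :
    StepsTo (m + n) σ π := by
  induction m generalizing σ with
  | zero => cases h; simpa using h'
  | succ m ih =>
    obtain ⟨ρ, h1, h2⟩ := h
    rw [Nat.succ_add]
    exact ⟨ρ, h1, ih _ h2⟩

theorem steps_cons (m : ℕ) (a : ℤ) (σ τ : List ℤ) (h : StepsTo m σ τ) :
    StepsTo m (a :: σ) (a :: τ) := by
  induction m generalizing σ with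
  | zero => cases h; rfl
  | succ m ih =>
    obtain ⟨ρ, ⟨l₁, l₂, c, d, hcd, rfl, rfl⟩, h2⟩ := h
    exact ⟨_, ⟨a :: l₁, l₂, c, d, hcd, rfl, rfl⟩, ih _ h2⟩

theorem perm_steps (σ π : List ℤ) (h : σ.Perm π) : ∃ n, StepsTo n σ π := by
  induction h with
  | nil => exact ⟨0, rfl⟩
  | cons a _ ih => obtain ⟨n, hn⟩ := ih; exact ⟨n, steps_cons _ _ _ _ hn⟩
  | swap a b l =>
    by_cases h : b = a
    · subst h; exact ⟨0, rfl⟩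
    · exact ⟨1, _, ⟨[], l, b, a, h, rfl, rfl⟩, rfl⟩
  | trans _ _ ih1 ih2 =>
    obtain ⟨n, hn⟩ := ih1
    obtain ⟨m, hm⟩ := ih2
    exact ⟨n + m, steps_trans _ _ _ _ _ hn hm⟩

theorem idist_le_dK (N n : ℕ) (σ π : List ℤ) (h : permList N σ) (h' : permList N π) :
    idist n (fun a => invc (a : ℤ) σ) (fun a => invc (a : ℤ) π) ≤ dK σ π := by
  have hne : {n | StepsTo n σ π}.Nonempty :=
    perm_steps _ _ (((permList_iff _ _).1 h).trans ((permList_iff _ _).1 h').symm)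
  exact steps_idist n _ _ _ (Nat.sInf_mem hne)

theorem ncard_perm (k : ℕ) : {σ | permList k σ}.ncard = Nat.factorial k := by
  have hnd : (rangeList 1 k).Nodup := by
    rw [rangeList_eq]
    exact (List.nodup_range' ).map Nat.cast_injective
  have : {σ | permList k σ} = ((rangeList 1 k).permutations.toFinset : Set (List ℤ)) := by
    ext σ
    simp [permList_iff, List.mem_permutations]
  rw [this, Set.ncard_coe_finset, List.toFinset_card_of_nodup (List.nodup_permutations _ hnd),
    List.length_permutations]
  simp [rangeList_eq]

open Polynomial in
theorem color_inj (n t p : ℕ) [Fact p.Prime] (hp : n < p) (x y : ℕ → ℕ)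
    (hd : idist n x y ≤ 2 * t)
    (hs : ((∑ a ∈ Finset.Icc 1 n, x a : ℕ) : ZMod (2 * t + 1)) = ((∑ a ∈ Finset.Icc 1 n, y a : ℕ) : ZMod (2 * t + 1)))
    (hc : ∀ i ≤ t, (∏ a ∈ Finset.Icc 1 n, (X - C (a : ZMod p)) ^ (x a)).coeff i =
       (∏ a ∈ Finset.Icc 1 n, (X - C (a : ZMod p)) ^ (y a)).coeff i) :
    ∀ a ∈ Finset.Icc 1 n, x a = y a := by
  set S := Finset.Icc 1 n with hS
  -- sums agree
  have hsum : ∑ a ∈ S, x a = ∑ a ∈ S, y a := by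
    have h1 : ((2 * t + 1 : ℕ) : ℤ) ∣ (∑ a ∈ S, ((x a : ℤ) - y a)) := by
      rw [← ZMod.intCast_zmod_eq_zero_iff_dvd]
      rw [Finset.sum_sub_distrib]
      push_cast at hs ⊢
      rw [hs, sub_self]
    have h2 : |∑ a ∈ S, ((x a : ℤ) - y a)| ≤ 2 * t := (Finset.abs_sum_le_sum_abs _ _).trans hd
    have h3 := Int.eq_zero_of_abs_lt_dvd h1 (by push_cast; omega)
    rw [Finset.sum_sub_distrib, sub_eq_zero] at h3
    exact_mod_cast h3
  set F : (ℕ → ℕ) → (ZMod p)[X] := fun x => ∏ a ∈ S, (X - C (a : ZMod p)) ^ (x a) with hF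
  set m : ℕ → ℕ := fun a => min (x a) (y a)
  set u : ℕ → ℕ := fun a => x a - m a
  set v : ℕ → ℕ := fun a => y a - m a
  have hxu : F x = F m * F u := by
    simp only [hF, ← Finset.prod_mul_distrib, ← pow_add]
    refine Finset.prod_congr rfl fun a _ => ?_
    congr 1; simp only [u, m]; omega
  have hyv : F y = F m * F v := by
    simp only [hF, ← Finset.prod_mul_distrib, ← pow_add]
    refine Finset.prod_congr rfl fun a _ => ?_
    congr 1; simp only [v, m]; omega
  have hdeg : ∀ w, (F w).natDegree = ∑ a ∈ S, w a := by
    intro w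
    rw [hF]
    simp only
    rw [natDegree_prod_of_monic _ _ (fun a _ => (monic_X_sub_C _).pow _)]
    refine Finset.sum_congr rfl fun a _ => ?_
    rw [natDegree_pow, natDegree_X_sub_C, mul_one]
  have huv : ∑ a ∈ S, u a = ∑ a ∈ S, v a := by
    have e1 : ∑ a ∈ S, x a = ∑ a ∈ S, m a + ∑ a ∈ S, u a := by
      rw [← Finset.sum_add_distrib]
      refine Finset.sum_congr rfl fun a _ => ?_
      simp only [u, m]; omega
    have e2 : ∑ a ∈ S, y a = ∑ a ∈ S, m a + ∑ a ∈ S, v a := by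
      rw [← Finset.sum_add_distrib]
      refine Finset.sum_congr rfl fun a _ => ?_
      simp only [v, m]; omega
    omega
  have hut : ∑ a ∈ S, u a ≤ t := by
    have : ((∑ a ∈ S, u a : ℕ) : ℤ) + ((∑ a ∈ S, v a : ℕ) : ℤ) = idist n x y := by
      unfold idist
      push_cast
      rw [← Finset.sum_add_distrib]
      refine Finset.sum_congr rfl fun a _ => ?_
      simp only [u, v, m]
      rcases le_total (x a) (y a) with h | h
      · rw [abs_of_nonpos (by omega), min_eq_left h]; omega
      · rw [abs_of_nonneg (by omega), min_eq_right h]; omega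
    omega
  have hne : ∀ a ∈ S, (a : ZMod p) ≠ 0 := by
    intro a ha
    rw [Finset.mem_Icc] at ha
    rw [Ne, ZMod.natCast_eq_zero_iff]
    intro h
    have := Nat.le_of_dvd (by omega) h
    omega
  have hinj : ∀ a ∈ S, ∀ b ∈ S, (a : ZMod p) = b → a = b := by
    intro a ha b hb h
    rw [Finset.mem_Icc] at ha hb
    rw [ZMod.natCast_eq_natCast_iff'] at h
    rwa [Nat.mod_eq_of_lt (by omega), Nat.mod_eq_of_lt (by omega)] at h
  have hdvd : X ^ (t + 1) ∣ F m * (F u - F v) := by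
    rw [mul_sub, ← hxu, ← hyv, X_pow_dvd_iff]
    intro d hd
    rw [coeff_sub, sub_eq_zero]
    exact hc d (by omega)
  have hcop : IsCoprime (X ^ (t + 1)) (F m) := by
    apply IsCoprime.pow_left
    apply IsCoprime.prod_right
    intro a ha
    apply IsCoprime.pow_right
    have := isCoprime_X_sub_C_of_isUnit_sub (R := ZMod p) (a := 0) (b := (a : ZMod p))
      (by rw [zero_sub, isUnit_iff_ne_zero, neg_ne_zero]; exact hne a ha)
    simpa using this
  have hdvd2 : X ^ (t + 1) ∣ F u - F v := hcop.dvd_of_dvd_mul_left hdvd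
  have heq : F u = F v := by
    rw [← sub_eq_zero]
    apply eq_zero_of_dvd_of_natDegree_lt hdvd2
    rw [natDegree_X_pow]
    refine lt_of_le_of_lt (natDegree_sub_le _ _) ?_
    rw [hdeg, hdeg, max_lt_iff]; omega
  have hroot : ∀ w, ∀ a ∈ S, (F w).eval (a : ZMod p) = 0 ↔ w a ≠ 0 := by
    intro w a ha
    simp only [hF]
    rw [eval_prod, Finset.prod_eq_zero_iff]
    constructor
    · rintro ⟨b, hb, h⟩
      rw [eval_pow, eval_sub, eval_X, eval_C] at h
      have h' := (pow_eq_zero_iff (n := w b) (Nat.pos_iff_ne_zero.1 <| by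
        rcases Nat.eq_zero_or_pos (w b) with h0 | h0
        · rw [h0] at h; simp at h
        · exact h0)).1 h
      have := hinj a ha b hb (sub_eq_zero.1 h')
      subst this
      intro h0; rw [h0] at h; simp at h
    · intro h
      exact ⟨a, ha, by simp [h]⟩
  intro a ha
  have h1 := hroot u a ha
  rw [heq, hroot v a ha] at h1
  simp only [u, v, m] at h1
  omega

open Polynomial in
/-- the colour (syndrome) of a vector -/
noncomputable def colr (n t p : ℕ) (x : ℕ → ℕ) : (Fin (t + 1) → ZMod p) × ZMod (2 * t + 1) :=
  (fun i => (∏ a ∈ Finset.Icc 1 n, (X - C (a : ZMod p)) ^ (x a)).coeff i,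
    ((∑ a ∈ Finset.Icc 1 n, x a : ℕ) : ZMod (2 * t + 1)))

theorem colr_inj (n t p : ℕ) [Fact p.Prime] (hp : n < p) (x y : ℕ → ℕ)
    (hd : idist n x y ≤ 2 * t) (hc : colr n t p x = colr n t p y) :
    ∀ a ∈ Finset.Icc 1 n, x a = y a := by
  rw [colr, colr, Prod.mk.injEq] at hc
  refine color_inj n t p hp x y hd hc.2 fun i hi => ?_
  exact congrFun hc.1 ⟨i, by omega⟩

/-- extend a vector by zero, shifting indices by one -/
def extv (r : ℕ) (v : Fin r → ℕ) : ℕ → ℕ := fun a => if h : a - 1 < r then v ⟨a - 1, h⟩ else 0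

theorem idist_mono (k r : ℕ) (x y : ℕ → ℕ) : idist k x y ≤ idist (k + r) x y := by
  unfold idist
  apply Finset.sum_le_sum_of_subset_of_nonneg
  · exact Finset.Icc_subset_Icc_right (by omega)
  · intros; exact abs_nonneg _

theorem idist_shift (k r : ℕ) (x y : ℕ → ℕ) :
    idist r (fun a => x (a + k)) (fun a => y (a + k)) ≤ idist (k + r) x y := by
  unfold idist
  have := Finset.sum_map (Finset.Icc 1 r) (addRightEmbedding k) (fun a => |(x a : ℤ) - (y a : ℤ)|)
  simp only [addRightEmbedding_apply] at this
  rw [← this]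
  apply Finset.sum_le_sum_of_subset_of_nonneg
  · intro a ha
    simp only [Finset.mem_map, Finset.mem_Icc, addRightEmbedding_apply] at ha ⊢
    omega
  · intros; exact abs_nonneg _

theorem idist_congr (n : ℕ) (x y z w : ℕ → ℕ) (h : ∀ a, 1 ≤ a → a ≤ n → x a = z a)
    (h' : ∀ a, 1 ≤ a → a ≤ n → y a = w a) : idist n x y = idist n z w := by
  unfold idist
  refine Finset.sum_congr rfl fun a ha => ?_
  rw [Finset.mem_Icc] at ha
  rw [h a ha.1 ha.2, h' a ha.1 ha.2]

theorem code_exists (k r t p q : ℕ) [Fact p.Prime] [Fact q.Prime] (hp : k < p) (hq : r < q)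
    (hcard : (q ^ (t + 1) * (2 * t + 1)) * (p ^ (t + 1) * (2 * t + 1)) ≤
      ∏ i ∈ Finset.range r, (k + 1 + i)) :
    ∃ C : Set (List ℤ),
          (∀ α ∈ C, permList (k + r) α) ∧
          C.ncard = Nat.factorial k ∧
          (∀ σ : List ℤ, permList k σ → ∃! α, α ∈ C ∧ restrictTo k α = σ) ∧
          (∀ α ∈ C, ∀ β ∈ C, α ≠ β → 2 * t + 1 ≤ dK α β) := by
  classical
  have hcc : ∀ s [Fact s.Prime], Fintype.card ((Fin (t + 1) → ZMod s) × ZMod (2 * t + 1)) =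
      s ^ (t + 1) * (2 * t + 1) := by
    intro s _
    simp [ZMod.card]
  -- pigeonhole
  let V : Finset (Fin r → ℕ) := Fintype.piFinset (fun i : Fin r => Finset.range (k + 1 + i))
  have hV : V.card = ∏ i ∈ Finset.range r, (k + 1 + i) := by
    simp only [V, Fintype.card_piFinset, Finset.card_range]
    exact Fin.prod_univ_eq_prod_range (fun i => k + 1 + i) r
  obtain ⟨c, -, hc⟩ := Finset.exists_le_card_fiber_of_mul_le_card_of_maps_to
    (s := V) (t := Finset.univ) (f := fun v => colr r t q (extv r v))
    (n := p ^ (t + 1) * (2 * t + 1)) (fun _ _ => Finset.mem_univ _) Finset.univ_nonempty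
    (by rw [Finset.card_univ, hcc q, hV]; exact hcard)
  set W := V.filter (fun v => colr r t q (extv r v) = c) with hW
  have hemb : Nonempty (((Fin (t + 1) → ZMod p) × ZMod (2 * t + 1)) ↪ W) := by
    apply Function.Embedding.nonempty_of_card_le
    rw [hcc p, Fintype.card_coe]; exact hc
  obtain ⟨ι⟩ := hemb
  let iv : List ℤ → ℕ → ℕ := fun σ a => invc (a : ℤ) σ
  let w : List ℤ → Fin r → ℕ := fun σ => (ι (colr k t p (iv σ)) : Fin r → ℕ)
  have hwV : ∀ σ, ∀ i : Fin r, w σ i < k + 1 + i := by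
    intro σ i
    have h1 := (ι (colr k t p (iv σ))).2
    have h2 := (Finset.mem_filter.1 h1).1
    exact Finset.mem_range.1 (Fintype.mem_piFinset.1 h2 i)
  have hwc : ∀ σ, colr r t q (extv r (w σ)) = c := by
    intro σ
    have h1 := (ι (colr k t p (iv σ))).2
    exact (Finset.mem_filter.1 h1).2
  let X : List ℤ → ℕ → ℕ := fun σ a => if a ≤ k then iv σ a else extv r (w σ) (a - k)
  let g : List ℤ → List ℤ := fun σ => bld (X σ) (k + r)
  have hXlt : ∀ σ, permList k σ → ∀ a, 1 ≤ a → a ≤ k + r → X σ a < a := by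
    intro σ hσ a h1 h2
    simp only [X]
    split_ifs with h
    · exact invc_lt k σ hσ a h1 h
    · have h3 : a - k - 1 < r := by omega
      simp only [extv, h3, dif_pos]
      have := hwV σ ⟨a - k - 1, h3⟩
      simp only at this
      omega
  have hres : ∀ σ, permList k σ → restrictTo k (g σ) = σ := by
    intro σ hσ
    simp only [g]
    rw [restrict_bld]
    apply permList_restrict k _ σ hσ
    intro a _ h2
    simp [X, h2, iv]
  refine ⟨g '' {σ | permList k σ}, ?_, ?_, ?_, ?_⟩
  · rintro _ ⟨σ, _, rfl⟩
    exact permList_bld _ _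
  · rw [Set.InjOn.ncard_image, ncard_perm]
    intro σ hσ τ hτ h
    rw [← hres σ hσ, h, hres τ hτ]
  · intro σ hσ
    refine ⟨g σ, ⟨⟨σ, hσ, rfl⟩, hres σ hσ⟩, ?_⟩
    rintro _ ⟨⟨τ, hτ, rfl⟩, h⟩
    rw [hres τ hτ] at h
    rw [h]
  · rintro _ ⟨σ, hσ, rfl⟩ _ ⟨τ, hτ, rfl⟩ hne
    by_contra hlt
    have hD : idist (k + r) (X σ) (X τ) ≤ 2 * t := by
      have h1 := idist_le_dK (k + r) (k + r) (g σ) (g τ) (permList_bld _ _) (permList_bld _ _)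
      rw [idist_congr (k + r) _ _ (X σ) (X τ) (fun a h1 h2 => invc_bld _ _ (hXlt σ hσ) a h1 h2)
        (fun a h1 h2 => invc_bld _ _ (hXlt τ hτ) a h1 h2)] at h1
      omega
    by_cases hcol : colr k t p (iv σ) = colr k t p (iv τ)
    · have h1 : idist k (iv σ) (iv τ) ≤ 2 * t := by
        refine le_trans (le_of_eq ?_) ((idist_mono k r (X σ) (X τ)).trans hD)
        apply idist_congr
        · intro a _ h; simp [X, h]
        · intro a _ h; simp [X, h]
      have h2 := colr_inj k t p hp _ _ h1 hcol
      apply hne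
      have h3 : σ = τ := by
        rw [← permList_restrict k (iv σ) σ hσ (fun _ _ _ => rfl)]
        exact permList_restrict k (iv σ) τ hτ (fun a h h' => h2 a (Finset.mem_Icc.2 ⟨h, h'⟩))
      rw [h3]
    · have h1 : idist r (extv r (w σ)) (extv r (w τ)) ≤ 2 * t := by
        refine le_trans (le_of_eq ?_) ((idist_shift k r (X σ) (X τ)).trans hD)
        apply idist_congr
        · intro a h _
          have : ¬ a + k ≤ k := by omega
          simp [X, this]
        · intro a h _
          have : ¬ a + k ≤ k := by omega
          simp [X, this]
      have h2 := colr_inj r t q hq _ _ h1 ((hwc σ).trans (hwc τ).symm)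
      apply hcol
      apply ι.injective
      apply Subtype.ext
      funext i
      have := h2 (i + 1) (Finset.mem_Icc.2 ⟨by omega, by omega⟩)
      simpa [extv] using this

theorem asymp (ε μ : ℝ) (hε : 0 < ε) (hμ : 0 < μ)
    (hμ₁ : ε ≤ 1 → 1 + ε < μ) (hμ₂ : 1 < ε → 1 + 1 / ε < μ) :
    ∃ K : ℕ, ∀ k : ℕ, K ≤ k → ∀ t r : ℕ, 0 < t → (t : ℝ) = (k : ℝ) ^ ε → r = ⌈μ * (t : ℝ)⌉₊ →
      0 < k ∧ 0 < r ∧ ((2 * r) ^ (t + 1) * (2 * t + 1)) * ((2 * k) ^ (t + 1) * (2 * t + 1)) ≤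
      ∏ i ∈ Finset.range r, (k + 1 + i) := by
  have hμ1 : 1 < μ := by
    rcases le_or_gt ε 1 with h | h
    · linarith [hμ₁ h]
    · have := hμ₂ h
      have : 0 < 1 / ε := by positivity
      linarith
  obtain ⟨δ, hδ, hd1, hd2⟩ : ∃ δ : ℝ, 0 < δ ∧ (ε ≤ 1 → 1 + ε + δ = μ) ∧
      (1 < ε → 1 + ε + δ = ε * μ) := by
    rcases le_or_gt ε 1 with h | h
    · exact ⟨μ - 1 - ε, by linarith [hμ₁ h], fun _ => by ring, fun h' => by linarith⟩
    · refine ⟨ε * μ - 1 - ε, ?_, fun h' => by linarith, fun _ => by ring⟩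
      have := mul_lt_mul_of_pos_left (hμ₂ h) hε
      rw [mul_add, mul_one_div_cancel hε.ne'] at this
      linarith
  set A : ℝ := 4 * (μ + 1) with hA
  have hA1 : 1 ≤ A := by rw [hA]; linarith
  have hlA : 0 ≤ Real.log A := Real.log_nonneg hA1
  have hl3 : 0 ≤ Real.log 3 := Real.log_nonneg (by norm_num)
  have ev1 : ∀ᶠ k : ℕ in Filter.atTop, 2 * (1 + 3 * ε) / δ ≤ (k : ℝ) ^ ε :=
    ((tendsto_rpow_atTop hε).comp tendsto_natCast_atTop_atTop).eventually_ge_atTop _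
  have ev1' : ∀ᶠ k : ℕ in Filter.atTop, Real.exp 1 ≤ (k : ℝ) ^ ε :=
    ((tendsto_rpow_atTop hε).comp tendsto_natCast_atTop_atTop).eventually_ge_atTop _
  have ev2 : ∀ᶠ k : ℕ in Filter.atTop,
      2 * (μ + 2 * Real.log A + 2 * Real.log 3) / δ ≤ Real.log (k : ℝ) :=
    (Real.tendsto_log_atTop.comp tendsto_natCast_atTop_atTop).eventually_ge_atTop _
  obtain ⟨K, hK⟩ := Filter.eventually_atTop.1
    (ev1.and (ev1'.and (ev2.and (Filter.eventually_ge_atTop 1))))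
  refine ⟨K, fun k hk t r ht htk hr => ?_⟩
  obtain ⟨h1, h2, h3, h4⟩ := hK k hk
  rw [← htk] at h1 h2
  have hk0 : (0 : ℝ) < k := by exact_mod_cast h4
  have ht1 : (1 : ℝ) ≤ t := by exact_mod_cast ht
  have hr1 : μ * t ≤ r := by rw [hr]; exact Nat.le_ceil _
  have hr2 : (r : ℝ) ≤ (μ + 1) * t := by
    have := Nat.ceil_lt_add_one (a := μ * t) (by positivity)
    rw [← hr] at this
    linarith
  have hr0 : (0 : ℝ) < r := lt_of_lt_of_le (by positivity) hr1
  refine ⟨h4, by exact_mod_cast hr0, ?_⟩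
  set L := Real.log (k : ℝ) with hL
  have hLt : Real.log t = ε * L := by rw [htk, Real.log_rpow hk0]
  have hL0 : 0 ≤ L := Real.log_nonneg (by exact_mod_cast h4)
  set P : ℝ := ∏ i ∈ Finset.range r, ((k : ℝ) + 1 + i) with hP
  have hP0 : 0 < P := Finset.prod_pos fun i _ => by positivity
  -- lower bound
  have hlow : (1 + ε + δ) * t * L - μ * t ≤ Real.log P := by
    rcases le_or_gt ε 1 with h | h
    · have hb : (k : ℝ) ^ r ≤ P := by
        have := Finset.prod_le_prod (s := Finset.range r) (f := fun _ => (k : ℝ))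
          (g := fun i : ℕ => (k : ℝ) + 1 + i) (fun i _ => hk0.le)
          (fun i _ => by have : (0 : ℝ) ≤ i := by positivity
                         linarith)
        simpa using this
      have := Real.log_le_log (by positivity) hb
      rw [Real.log_pow] at this
      rw [hd1 h]
      have h5 := mul_le_mul_of_nonneg_right hr1 hL0
      have : 0 ≤ μ * t := by positivity
      linarith
    · have hb : (r.factorial : ℝ) ≤ P := by
        rw [← Finset.prod_range_add_one_eq_factorial]
        push_cast
        apply Finset.prod_le_prod
        · intros; positivity
        · intros; linarith
      have hst : (r : ℝ) ^ r / Real.exp 1 ^ r ≤ r.factorial := by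
        have h6 := Real.pow_div_factorial_le_exp (r : ℝ) hr0.le r
        rw [div_le_iff₀ (by positivity)] at h6 ⊢
        rw [← Real.exp_nat_mul, mul_one, mul_comm]
        exact h6
      have h7 : ((t : ℝ) / Real.exp 1) ^ r ≤ P := by
        refine le_trans ?_ (hst.trans hb)
        rw [← div_pow]
        have : (t : ℝ) ≤ r := by nlinarith
        gcongr
      have h8 := Real.log_le_log (by positivity) h7
      rw [Real.log_pow, Real.log_div (by positivity) (by positivity), Real.log_exp, hLt] at h8
      have h9 : 0 ≤ ε * L - 1 := by
        have := Real.log_le_log (by positivity) h2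
        rw [Real.log_exp, hLt] at this
        linarith
      have := mul_le_mul_of_nonneg_right hr1 h9
      rw [hd2 h]
      linarith
  -- upper bound
  have hup : ((2 * r : ℝ) ^ (t + 1) * (2 * t + 1)) * ((2 * k) ^ (t + 1) * (2 * t + 1)) ≤
      (A * t * k) ^ (t + 1) * (3 * t) ^ 2 := by
    have e : ((2 * r : ℝ) ^ (t + 1) * (2 * t + 1)) * ((2 * k) ^ (t + 1) * (2 * t + 1)) =
      (4 * r * k) ^ (t + 1) * (2 * t + 1) ^ 2 := by
      rw [show (4 * r * k : ℝ) = (2 * r) * (2 * k) by ring, mul_pow (2 * r : ℝ) (2 * k)]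
      generalize (2 * r : ℝ) ^ (t + 1) = a
      generalize (2 * k : ℝ) ^ (t + 1) = b
      ring
    rw [e]
    have : (4 * r : ℝ) ≤ A * t := by rw [hA]; linarith
    gcongr
    linarith
  have hfin : (A * t * k) ^ (t + 1) * (3 * t) ^ 2 ≤ P := by
    rw [← Real.log_le_log_iff (by positivity) hP0]
    refine le_trans ?_ hlow
    have hA0 : A ≠ 0 := by positivity
    have ht0 : (t : ℝ) ≠ 0 := by positivity
    have l1 : Real.log (A * t * k) = Real.log A + ε * L + L := by
      rw [Real.log_mul (mul_ne_zero hA0 ht0) hk0.ne', Real.log_mul hA0 ht0, hLt]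
    have l2 : Real.log (3 * t) = Real.log 3 + ε * L := by
      rw [Real.log_mul (by norm_num) ht0, hLt]
    rw [Real.log_mul (by positivity) (by positivity), Real.log_pow, Real.log_pow, l1, l2]
    push_cast
    rw [div_le_iff₀ hδ] at h1 h3
    have e1 := mul_le_mul_of_nonneg_right h1 hL0
    have e2 := mul_le_mul_of_nonneg_right h3 (by linarith : (0 : ℝ) ≤ t)
    have e3 := mul_le_mul_of_nonneg_right ht1 hlA
    have e4 := mul_le_mul_of_nonneg_right ht1 hl3
    nlinarith
  have := hup.trans hfin
  rw [hP] at this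
  exact_mod_cast this

end Helpers

/-- Theorem 6, main theorem. Let `ε > 0` and `μ > 0` satisfy
`μ > 1 + ε` if `ε ≤ 1` and `μ > 1 + 1/ε` if `ε > 1`.  Then there exists `K` such that for
every integer `k ≥ K` with `k - 2` a power of a prime, if `t = k^ε` is a positive integer
and `r = ⌈μt⌉` with `r - 1` a power of a prime, then there exists a `(k+r, k)` systematic
`t`-error-correcting code: a code `C ⊆ S_{k+r}` of size `k!` such that every `σ ∈ S_k` is
the restriction of exactly one codeword of `C`, and distinct codewords of `C` are at
Kendall τ-distance at least `2t + 1`. -/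
theorem stmt18 (ε μ : ℝ) (hε : 0 < ε) (hμ : 0 < μ)
    (hμ₁ : ε ≤ 1 → 1 + ε < μ) (hμ₂ : 1 < ε → 1 + 1 / ε < μ) :
    ∃ K : ℕ, ∀ k : ℕ, K ≤ k → IsPrimePow (k - 2) →
      ∀ t r : ℕ, 0 < t → (t : ℝ) = (k : ℝ) ^ ε → r = ⌈μ * (t : ℝ)⌉₊ → IsPrimePow (r - 1) →
        ∃ C : Set (List ℤ),
          (∀ α ∈ C, permList (k + r) α) ∧
          C.ncard = Nat.factorial k ∧
          (∀ σ : List ℤ, permList k σ → ∃! α, α ∈ C ∧ restrictTo k α = σ) ∧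
          (∀ α ∈ C, ∀ β ∈ C, α ≠ β → 2 * t + 1 ≤ dK α β) := by

  obtain ⟨K, hK⟩ := asymp ε μ hε hμ hμ₁ hμ₂
  refine ⟨K, fun k hk _ t r ht htk hr _ => ?_⟩
  obtain ⟨hk0, hr0, hle⟩ := hK k hk t r ht htk hr
  obtain ⟨p, hp, hkp, hpk⟩ := Nat.exists_prime_lt_and_le_two_mul k hk0.ne'
  obtain ⟨q, hq, hrq, hqr⟩ := Nat.exists_prime_lt_and_le_two_mul r hr0.ne'
  have : Fact p.Prime := ⟨hp⟩
  have : Fact q.Prime := ⟨hq⟩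
  refine code_exists k r t p q hkp hrq (le_trans ?_ hle)
  gcongr
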